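/- Let τ ∈ ℂ with Im τ > 0 and θ(z) = θ₁(z,τ). Let w, X, X', Y, Z, Z' ∈ ℂ be such that θ(X'−Z), θ(Y−Z'), θ(w−X+Z'−Z) and θ(w−Y+X'−X) are all nonzero. Define X₂ = [θ(X'−Z')·θ(Y−Z)·θ(w−X)·θ(w−Y+X'−X+Z'−Z)] / [θ(X'−Z)·θ(Y−Z')·θ(w−X+Z'−Z)·θ(w−Y+X'−X)] and Y₂ = [θ(Z−Z')·θ(X'−Y)·θ(w−Z+X'−X)·θ(w−Y+Z'−X)] / [θ(X'−Z)·θ(Y−Z')·θ(w−X+Z'−Z)·θ(w−Y+X'−X)]. Then X₂ + Y₂ = 1. (This is the Fermat relation x₂^N + y₂^N = 1 for the second Fermat point of the theta-function parameterized R-matrix, in genus one.) -/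

import Mathlib

/-- The odd Jacobi theta function
`θ₁(z,τ) = -i ∑_{n ∈ ℤ} (-1)^n exp(iπτ(n+1/2)²) exp((2n+1)iπz)`. -/
noncomputable def theta1 (z τ : ℂ) : ℂ :=
  -Complex.I * ∑' n : ℤ,
    (-1 : ℂ) ^ n * Complex.exp ((Real.pi : ℂ) * Complex.I * τ * ((n : ℂ) + 1 / 2) ^ 2) *
      Complex.exp ((2 * (n : ℂ) + 1) * (Real.pi : ℂ) * Complex.I * z)

theorem theta1_term_eq (n : ℤ) (z τ : ℂ) :
    (-1 : ℂ) ^ n * Complex.exp ((Real.pi : ℂ) * Complex.I * τ * ((n : ℂ) + 1 / 2) ^ 2) *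
        Complex.exp ((2 * (n : ℂ) + 1) * (Real.pi : ℂ) * Complex.I * z) =
      Complex.exp ((Real.pi : ℂ) * Complex.I * (τ / 4 + z)) *
        jacobiTheta₂_term n (z + τ / 2 + 1 / 2) τ := by
  rw [← Complex.exp_pi_mul_I, ← Complex.exp_int_mul, jacobiTheta₂_term, ← Complex.exp_add,
    ← Complex.exp_add, ← Complex.exp_add]
  congr 1
  ring

theorem summable_theta1_term (z : ℂ) {τ : ℂ} (hτ : 0 < τ.im) :
    Summable fun n : ℤ ↦
      (-1 : ℂ) ^ n * Complex.exp ((Real.pi : ℂ) * Complex.I * τ * ((n : ℂ) + 1 / 2) ^ 2) *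
        Complex.exp ((2 * (n : ℂ) + 1) * (Real.pi : ℂ) * Complex.I * z) := by
  simp_rw [theta1_term_eq]
  exact ((summable_jacobiTheta₂_term_iff _ τ).2 hτ).mul_left _

/-- The even theta function of nome `2τ` with half-integral characteristic, as a multiple of a
translate of `jacobiTheta₂`. -/
noncomputable def thetaHalf (z τ : ℂ) : ℂ :=
  Complex.exp ((Real.pi : ℂ) * Complex.I * (τ / 2 + 2 * z)) * jacobiTheta₂ (2 * z + τ) (2 * τ)

theorem hasSum_mul_prod {ι κ : Type*} {f : ι → ℂ} {g : κ → ℂ} {a b : ℂ}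
    (hf : HasSum f a) (hg : HasSum g b) : HasSum (fun p : ι × κ ↦ f p.1 * g p.2) (a * b) :=
  hf.mul hg (summable_mul_of_summable_norm hf.summable.norm hg.summable.norm)

/-- Sums over pairs of integers split according to the parity of the sum of the two entries. -/
theorem hasSum_int_prod_of_parity {f : ℤ × ℤ → ℂ} {a b : ℂ}
    (ha : HasSum (fun p : ℤ × ℤ ↦ f (p.1 + p.2, p.1 - p.2 - 1)) a)
    (hb : HasSum (fun p : ℤ × ℤ ↦ f (p.1 + p.2, p.1 - p.2)) b) : HasSum f (a + b) := by
  let φ : ℤ × ℤ → ℤ × ℤ := fun p ↦ (p.1 + p.2, p.1 - p.2 - 1)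
  let ψ : ℤ × ℤ → ℤ × ℤ := fun p ↦ (p.1 + p.2, p.1 - p.2)
  have hφ : Function.Injective φ := by
    rintro ⟨a, b⟩ ⟨c, d⟩ h
    simp only [φ, Prod.mk.injEq] at h ⊢
    omega
  have hψ : Function.Injective ψ := by
    rintro ⟨a, b⟩ ⟨c, d⟩ h
    simp only [ψ, Prod.mk.injEq] at h ⊢
    omega
  have hc : IsCompl (Set.range φ) (Set.range ψ) := by
    refine ⟨Set.disjoint_left.2 ?_, codisjoint_iff_le_sup.2 ?_⟩
    · rintro _ ⟨⟨a, b⟩, rfl⟩ ⟨⟨c, d⟩, h⟩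
      simp only [φ, ψ, Prod.mk.injEq] at h
      omega
    · rintro ⟨n, m⟩ -
      rcases Int.even_or_odd' (n + m) with ⟨k, hk | hk⟩
      · refine Or.inr ⟨(k, n - k), ?_⟩
        simp only [ψ, Prod.mk.injEq]
        omega
      · refine Or.inl ⟨(k + 1, n - k - 1), ?_⟩
        simp only [φ, Prod.mk.injEq]
        omega
  exact HasSum.add_isCompl hc (hφ.hasSum_range_iff.2 ha) (hψ.hasSum_range_iff.2 hb)

/-- The addition formula expressing `θ₁(x + y) θ₁(x - y)` as a `2 × 2` determinant. -/
theorem theta1_add_mul_theta1_sub {τ : ℂ} (hτ : 0 < τ.im) (x y : ℂ) :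
    theta1 (x + y) τ * theta1 (x - y) τ =
      jacobiTheta₂ (2 * x) (2 * τ) * thetaHalf y τ -
        thetaHalf x τ * jacobiTheta₂ (2 * y) (2 * τ) := by
  have h2τ : 0 < (2 * τ).im := by simpa using hτ
  have hA (z : ℂ) := hasSum_jacobiTheta₂_term (2 * z) h2τ
  have hB (z : ℂ) : HasSum (fun n : ℤ ↦ Complex.exp ((Real.pi : ℂ) * Complex.I *
      (τ / 2 + 2 * z)) * jacobiTheta₂_term n (2 * z + τ) (2 * τ)) (thetaHalf z τ) :=
    (hasSum_jacobiTheta₂_term (2 * z + τ) h2τ).mul_left _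
  have hF := hasSum_mul_prod (summable_theta1_term (x + y) hτ).hasSum
    (summable_theta1_term (x - y) hτ).hasSum
  rw [theta1, theta1, mul_mul_mul_comm, hF.unique (hasSum_int_prod_of_parity
    ((hasSum_mul_prod (hA x) (hB y)).neg.congr_fun ?_)
    ((hasSum_mul_prod (hB x) (hA y)).congr_fun ?_))]
  · linear_combination (thetaHalf x τ * jacobiTheta₂ (2 * y) (2 * τ) -
      jacobiTheta₂ (2 * x) (2 * τ) * thetaHalf y τ) * Complex.I_sq
  · rintro ⟨p, q⟩
    have hs : (-1 : ℂ) ^ (p + q) * (-1 : ℂ) ^ (p - q - 1) = -1 := by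
      rw [← zpow_add₀ (by norm_num)]
      exact Odd.neg_one_zpow ⟨p - 1, by ring⟩
    simp only [jacobiTheta₂_term]
    rw [mul_assoc ((-1 : ℂ) ^ (p + q)), mul_assoc ((-1 : ℂ) ^ (p - q - 1)),
      mul_mul_mul_comm, hs, neg_one_mul]
    simp only [← Complex.exp_add]
    push_cast
    congr 2
    ring
  · rintro ⟨p, q⟩
    have hs : (-1 : ℂ) ^ (p + q) * (-1 : ℂ) ^ (p - q) = 1 := by
      rw [← zpow_add₀ (by norm_num)]
      exact Even.neg_one_zpow ⟨p, by ring⟩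
    simp only [jacobiTheta₂_term]
    rw [mul_assoc ((-1 : ℂ) ^ (p + q)), mul_assoc ((-1 : ℂ) ^ (p - q)),
      mul_mul_mul_comm, hs, one_mul]
    simp only [← Complex.exp_add]
    push_cast
    congr 1
    ring

/-- The three-term identity of Weierstrass for `θ₁`. -/
theorem theta1_three_term {τ : ℂ} (hτ : 0 < τ.im) (a b c d : ℂ) :
    theta1 (a + d) τ * theta1 (a - d) τ * (theta1 (c + b) τ * theta1 (c - b) τ) +
      theta1 (c + a) τ * theta1 (c - a) τ * (theta1 (d + b) τ * theta1 (d - b) τ) =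
    theta1 (a + b) τ * theta1 (a - b) τ * (theta1 (c + d) τ * theta1 (c - d) τ) := by
  simp only [theta1_add_mul_theta1_sub hτ]
  ring

/-- Genus-one Fermat relation `x₂^N + y₂^N = 1` for the second Fermat
point of the theta-function parameterized R-matrix: with `θ(z) = θ₁(z,τ)`, `Im τ > 0`,
and the stated denominators nonzero,
`X₂ = θ(X'-Z')θ(Y-Z)θ(w-X)θ(w-Y+X'-X+Z'-Z) / (θ(X'-Z)θ(Y-Z')θ(w-X+Z'-Z)θ(w-Y+X'-X))`
and
`Y₂ = θ(Z-Z')θ(X'-Y)θ(w-Z+X'-X)θ(w-Y+Z'-X) / (θ(X'-Z)θ(Y-Z')θ(w-X+Z'-Z)θ(w-Y+X'-X))`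
satisfy `X₂ + Y₂ = 1`. -/
theorem theta1_fermat_relation_second (τ : ℂ) (hτ : 0 < τ.im)
    (w X X' Y Z Z' : ℂ)
    (h1 : theta1 (X' - Z) τ ≠ 0) (h2 : theta1 (Y - Z') τ ≠ 0)
    (h3 : theta1 (w - X + Z' - Z) τ ≠ 0) (h4 : theta1 (w - Y + X' - X) τ ≠ 0) :
    (theta1 (X' - Z') τ * theta1 (Y - Z) τ * theta1 (w - X) τ *
        theta1 (w - Y + X' - X + Z' - Z) τ) /
      (theta1 (X' - Z) τ * theta1 (Y - Z') τ * theta1 (w - X + Z' - Z) τ *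
        theta1 (w - Y + X' - X) τ) +
    (theta1 (Z - Z') τ * theta1 (X' - Y) τ * theta1 (w - Z + X' - X) τ *
        theta1 (w - Y + Z' - X) τ) /
      (theta1 (X' - Z) τ * theta1 (Y - Z') τ * theta1 (w - X + Z' - Z) τ *
        theta1 (w - Y + X' - X) τ) = 1 := by
  rw [← add_div, div_eq_one_iff_eq (by simp [*])]
  have h := theta1_three_term hτ ((w - X + Y - Z) / 2) ((w - X - Y + 2 * Z' - Z) / 2)
    ((w - X - Y + 2 * X' - Z) / 2) ((w - X - Y + Z) / 2)
  ring_nf at h ⊢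
  linear_combination h
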